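/- arXiv:2308.08471 — 2 statements merged into one kernel-verified Lean document; each statement's English description precedes it below -/
import Mathlib

section
/- (Passivity.) Take the supply rate s(w,y) = wᵀy (with p = q). Suppose there exist scalars μ ≥ 0 and λ ≥ 0, a symmetric positive semidefinite matrix P_Δ, and a continuously differentiable function V : ℝⁿ → ℝ with V(0) = 0 and V(x) > 0 for x ≠ 0, such that for all ψ, x, v, ξ, w: ∇V(x)ᵀ f(x,v,w,ξ) + 2 ψᵀ P_Δ (A_Ψ ψ + B_Ψ (x,v,ξ)) ≤ wᵀ h(x,v) + λ ‖g(x,v,w,ξ)‖² + μ (C_Ψ ψ + D_Ψ (x,v,ξ))ᵀ M (C_Ψ ψ + D_Ψ (x,v,ξ)). Then along every trajectory of the DAE on [0,T] with associated filter trajectory whose output satisfies the hard IQC defined by (Ψ,M), it holds that V(x(T)) − V(x(0)) ≤ ∫₀ᵀ w(t)ᵀ y(t) dt where y(t) = h(x(t),v(t)); in particular, if x(0) = 0 then ∫₀ᵀ w(t)ᵀ y(t) dt ≥ 0. -/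
open Matrix MeasureTheory

lemma aux_append {X : Type*} [TopologicalSpace X] {a b : ℕ} {s : Set X}
    {u : X → Fin a → ℝ} {v : X → Fin b → ℝ} (hu : ContinuousOn u s) (hv : ContinuousOn v s) :
    ContinuousOn (fun t => Fin.append (u t) (v t)) s := by
  rw [continuousOn_pi] at *
  intro i
  refine Fin.addCases (fun j => ?_) (fun j => ?_) i
  · simpa using hu j
  · simpa using hv j

lemma aux_dot {X : Type*} [TopologicalSpace X] {a : ℕ} {s : Set X}
    {u v : X → Fin a → ℝ} (hu : ContinuousOn u s) (hv : ContinuousOn v s) :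
    ContinuousOn (fun t => u t ⬝ᵥ v t) s := by
  have : Continuous (fun q : (Fin a → ℝ) × (Fin a → ℝ) => q.1 ⬝ᵥ q.2) := by fun_prop
  exact this.comp_continuousOn (hu.prodMk hv)

lemma aux_mulVec {X : Type*} [TopologicalSpace X] {a b : ℕ} {s : Set X}
    (A : Matrix (Fin b) (Fin a) ℝ)
    {u : X → Fin a → ℝ} (hu : ContinuousOn u s) :
    ContinuousOn (fun t => A *ᵥ u t) s := by
  have : Continuous (fun q : (Fin a → ℝ) => A *ᵥ q) := by fun_prop
  exact this.comp_continuousOn hu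

lemma aux_deriv {a : ℕ} (P : Matrix (Fin a) (Fin a) ℝ) (hP : P.PosSemidef)
    (ψ : ℝ → Fin a → ℝ) (d : Fin a → ℝ) (t : ℝ) (hψ : HasDerivAt ψ d t) :
    HasDerivAt (fun s => ψ s ⬝ᵥ P *ᵥ ψ s) (2 * (ψ t ⬝ᵥ P *ᵥ d)) t := by
  have h2 : HasDerivAt (fun s => P *ᵥ ψ s) (P *ᵥ d) t :=
    (P.mulVecLin.toContinuousLinearMap.hasFDerivAt (x := ψ t)).comp_hasDerivAt t hψ
  have h3 : HasDerivAt (fun s => ψ s ⬝ᵥ P *ᵥ ψ s) (∑ i, (d i * (P *ᵥ ψ t) i + ψ t i * (P *ᵥ d) i)) t :=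
    HasDerivAt.fun_sum fun i _ => ((hasDerivAt_pi.1 hψ) i).mul ((hasDerivAt_pi.1 h2) i)
  convert h3 using 1
  have hs : Pᵀ = P := by simpa [Matrix.IsHermitian, conjTranspose_eq_transpose_of_trivial] using hP.1
  have h4 : d ⬝ᵥ P *ᵥ ψ t = ψ t ⬝ᵥ P *ᵥ d := by
    rw [dotProduct_mulVec, ← mulVec_transpose, hs, dotProduct_comm]
  rw [Finset.sum_add_distrib]
  change _ = d ⬝ᵥ P *ᵥ ψ t + ψ t ⬝ᵥ P *ᵥ d
  rw [h4]; ring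

/-- Passivity: under the dissipation certificate with the supply rate `s(w,y) = wᵀy`,
every trajectory of the uncertain DAE whose uncertainty satisfies the hard IQC defined by
`(Ψ, M)` satisfies `V(x(T)) − V(x(0)) ≤ ∫₀ᵀ wᵀ y` with `y = h(x,v)`; in particular, if
`x(0) = 0` then `∫₀ᵀ wᵀ y ≥ 0`. -/
theorem dae_passivity_of_certificate
    {n m p l r nψ nz : ℕ}
    (f : (Fin n → ℝ) → (Fin m → ℝ) → (Fin p → ℝ) → (Fin l → ℝ) → (Fin n → ℝ))
    (g : (Fin n → ℝ) → (Fin m → ℝ) → (Fin p → ℝ) → (Fin l → ℝ) → (Fin r → ℝ))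
    (h : (Fin n → ℝ) → (Fin m → ℝ) → (Fin p → ℝ))
    (hf : Continuous fun u : ((Fin n → ℝ) × (Fin m → ℝ) × (Fin p → ℝ) × (Fin l → ℝ)) =>
      f u.1 u.2.1 u.2.2.1 u.2.2.2)
    (hg : Continuous fun u : ((Fin n → ℝ) × (Fin m → ℝ) × (Fin p → ℝ) × (Fin l → ℝ)) =>
      g u.1 u.2.1 u.2.2.1 u.2.2.2)
    (hh : Continuous fun u : ((Fin n → ℝ) × (Fin m → ℝ)) => h u.1 u.2)
    (AΨ : Matrix (Fin nψ) (Fin nψ) ℝ) (BΨ : Matrix (Fin nψ) (Fin (n + m + l)) ℝ)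
    (CΨ : Matrix (Fin nz) (Fin nψ) ℝ) (DΨ : Matrix (Fin nz) (Fin (n + m + l)) ℝ)
    (M : Matrix (Fin nz) (Fin nz) ℝ) (hM : M.IsSymm)
    (μ lam : ℝ) (hμ : 0 ≤ μ) (hlam : 0 ≤ lam)
    (PΔ : Matrix (Fin nψ) (Fin nψ) ℝ) (hPΔ : PΔ.PosSemidef)
    (V : (Fin n → ℝ) → ℝ) (hV : ContDiff ℝ 1 V) (hV0 : V 0 = 0)
    (hVpos : ∀ x : Fin n → ℝ, x ≠ 0 → 0 < V x)
    (hcert : ∀ (ψ : Fin nψ → ℝ) (x : Fin n → ℝ) (v : Fin m → ℝ) (ξ : Fin l → ℝ)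
        (w : Fin p → ℝ),
      fderiv ℝ V x (f x v w ξ)
          + 2 * (ψ ⬝ᵥ PΔ *ᵥ (AΨ *ᵥ ψ + BΨ *ᵥ Fin.append (Fin.append x v) ξ))
        ≤ w ⬝ᵥ h x v + lam * (g x v w ξ ⬝ᵥ g x v w ξ)
          + μ * ((CΨ *ᵥ ψ + DΨ *ᵥ Fin.append (Fin.append x v) ξ) ⬝ᵥ
              M *ᵥ (CΨ *ᵥ ψ + DΨ *ᵥ Fin.append (Fin.append x v) ξ)))
    (T : ℝ) (hT : 0 ≤ T)
    (x : ℝ → Fin n → ℝ) (v : ℝ → Fin m → ℝ) (w : ℝ → Fin p → ℝ) (ξ : ℝ → Fin l → ℝ)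
    (ψ : ℝ → Fin nψ → ℝ)
    (hv : ContinuousOn v (Set.Icc 0 T)) (hw : ContinuousOn w (Set.Icc 0 T))
    (hξ : ContinuousOn ξ (Set.Icc 0 T))
    (hx : ∀ t ∈ Set.Icc (0 : ℝ) T, HasDerivAt x (f (x t) (v t) (w t) (ξ t)) t)
    (halg : ∀ t ∈ Set.Icc (0 : ℝ) T, g (x t) (v t) (w t) (ξ t) = 0)
    (hψ0 : ψ 0 = 0)
    (hψ : ∀ t ∈ Set.Icc (0 : ℝ) T,
      HasDerivAt ψ (AΨ *ᵥ ψ t + BΨ *ᵥ Fin.append (Fin.append (x t) (v t)) (ξ t)) t)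
    (hIQC : ∀ T' ∈ Set.Icc (0 : ℝ) T,
      (∫ t in (0 : ℝ)..T',
        (CΨ *ᵥ ψ t + DΨ *ᵥ Fin.append (Fin.append (x t) (v t)) (ξ t)) ⬝ᵥ
          M *ᵥ (CΨ *ᵥ ψ t + DΨ *ᵥ Fin.append (Fin.append (x t) (v t)) (ξ t))) ≤ 0) :
    V (x T) - V (x 0) ≤ (∫ t in (0 : ℝ)..T, w t ⬝ᵥ h (x t) (v t)) ∧
      (x 0 = 0 → 0 ≤ ∫ t in (0 : ℝ)..T, w t ⬝ᵥ h (x t) (v t)) := by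
  have hxc : ContinuousOn x (Set.Icc 0 T) := fun t ht => (hx t ht).continuousAt.continuousWithinAt
  have hψc : ContinuousOn ψ (Set.Icc 0 T) := fun t ht => (hψ t ht).continuousAt.continuousWithinAt
  have hac := aux_append (aux_append hxc hv) hξ
  have hz := (aux_mulVec CΨ hψc).add (aux_mulVec DΨ hac)
  have hq := aux_dot hz (aux_mulVec M hz)
  have hy : ContinuousOn (fun t => h (x t) (v t)) (Set.Icc 0 T) :=
    hh.comp_continuousOn (hxc.prodMk hv)
  have hwy := aux_dot hw hy
  have hS : ∀ t ∈ Set.Icc (0 : ℝ) T, HasDerivAt (fun s => V (x s) + ψ s ⬝ᵥ PΔ *ᵥ ψ s)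
      (fderiv ℝ V (x t) (f (x t) (v t) (w t) (ξ t)) + 2 * (ψ t ⬝ᵥ PΔ *ᵥ
        (AΨ *ᵥ ψ t + BΨ *ᵥ Fin.append (Fin.append (x t) (v t)) (ξ t)))) t := fun t ht =>
    (((hV.differentiable (by norm_num)) (x t)).hasFDerivAt.comp_hasDerivAt t (hx t ht)).add
      (aux_deriv PΔ hPΔ ψ _ t (hψ t ht))
  have key := intervalIntegral.sub_le_integral_of_hasDeriv_right_of_le hT
    (fun t ht => (hS t ht).continuousAt.continuousWithinAt)
    (fun t ht => (hS t (Set.Ioo_subset_Icc_self ht)).hasDerivWithinAt)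
    ((hwy.add (hq.const_smul μ)).integrableOn_Icc)
    (fun t ht => by
      have := hcert (ψ t) (x t) (v t) (ξ t) (w t)
      rw [halg t (Set.Ioo_subset_Icc_self ht)] at this
      simpa using this)
  have hI := hIQC T ⟨hT, le_rfl⟩
  have e : Set.uIcc 0 T = Set.Icc 0 T := Set.uIcc_of_le hT
  have i1 : IntervalIntegrable (fun t => w t ⬝ᵥ h (x t) (v t)) volume 0 T :=
    ContinuousOn.intervalIntegrable (by rw [e]; exact hwy)
  have i2 := ContinuousOn.intervalIntegrable (μ := volume) (by rw [e]; exact hq)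
  have hsplit := intervalIntegral.integral_add i1 (i2.const_mul μ)
  rw [intervalIntegral.integral_const_mul] at hsplit
  have hnn : 0 ≤ ψ T ⬝ᵥ PΔ *ᵥ ψ T := by simpa using hPΔ.dotProduct_mulVec_nonneg (ψ T)
  have hmain : V (x T) - V (x 0) ≤ (∫ t in (0 : ℝ)..T, w t ⬝ᵥ h (x t) (v t)) := by
    have hmul := mul_nonpos_of_nonneg_of_nonpos hμ hI
    have key2 := key.trans_eq hsplit
    simp only [hψ0, zero_dotProduct] at key2
    simp only [Pi.add_apply] at key2
    linarith
  refine ⟨hmain, fun h0 => ?_⟩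
  rw [h0, hV0] at hmain
  have : 0 ≤ V (x T) := by
    by_cases hc : x T = 0
    · rw [hc, hV0]
    · exact (hVpos _ hc).le
  linarith
end

section
/- (Sum-of-squares certificate implies dissipativity for polynomial DAE systems.) Let f, g, h be polynomial maps and s a polynomial supply rate. Suppose there exist scalars λ ≥ 0, μ ≥ 0, ε > 0, a symmetric positive semidefinite matrix P_Δ, and a polynomial V in x with V(0) = 0 such that (i) V(x) − ε xᵀx is a sum of squares of polynomials in x, and (ii) the polynomial s(w, h(x,v)) + λ ‖g(x,v,w,ξ)‖² + μ (C_Ψ ψ + D_Ψ (x,v,ξ))ᵀ M (C_Ψ ψ + D_Ψ (x,v,ξ)) − ∇V(x)ᵀ f(x,v,w,ξ) − 2 ψᵀ P_Δ (A_Ψ ψ + B_Ψ (x,v,ξ)) is a sum of squares of polynomials in the variables (x, v, w, ξ, ψ). Then for every trajectory (x,v,w,ξ) of the DAE on [0,T] with associated filter trajectory ψ (with ψ(0)=0) whose output satisfies the hard IQC defined by (Ψ,M), it holds that V(x(T)) − V(x(0)) ≤ ∫₀ᵀ s(w(t), h(x(t),v(t))) dt. -/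
open Matrix MeasureTheory

theorem aux_poly_diff {σ : Type*} [Fintype σ] (pV : MvPolynomial σ ℝ) :
    Differentiable ℝ (fun x : σ → ℝ => MvPolynomial.eval x pV) := by
  induction pV using MvPolynomial.induction_on with
  | C a => simp
  | add a b ha hb => simpa using ha.fun_add hb
  | mul_X a i ha =>
    simp only [map_mul, MvPolynomial.eval_X]
    exact ha.fun_mul (differentiable_apply i)

theorem aux_dot_deriv {k : ℕ} {a b : ℝ → Fin k → ℝ} {a' b' : Fin k → ℝ} {t : ℝ}
    (ha : HasDerivAt a a' t) (hb : HasDerivAt b b' t) :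
    HasDerivAt (fun t => a t ⬝ᵥ b t) (a' ⬝ᵥ b t + a t ⬝ᵥ b') t := by
  rw [hasDerivAt_pi] at ha hb
  have := HasDerivAt.fun_sum (u := Finset.univ) (fun i _ => (ha i).fun_mul (hb i))
  simpa only [dotProduct, Finset.sum_add_distrib] using this

theorem aux_mulVec_deriv {k j : ℕ} (P : Matrix (Fin j) (Fin k) ℝ) {a : ℝ → Fin k → ℝ}
    {a' : Fin k → ℝ} {t : ℝ} (ha : HasDerivAt a a' t) :
    HasDerivAt (fun t => P *ᵥ a t) (P *ᵥ a') t := by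
  rw [hasDerivAt_pi]
  intro i
  have := aux_dot_deriv (hasDerivAt_const t (P i)) ha
  simpa [Matrix.mulVec] using this

theorem aux_append_cont {a b : ℕ} {u : ℝ → Fin a → ℝ} {v : ℝ → Fin b → ℝ} {S : Set ℝ}
    (hu : ContinuousOn u S) (hv : ContinuousOn v S) :
    ContinuousOn (fun t => Fin.append (u t) (v t)) S := by
  rw [continuousOn_pi] at *
  intro i
  refine Fin.addCases (fun i => ?_) (fun i => ?_) i
  · simpa using hu i
  · simpa using hv i

theorem aux_elim_cont {α β : Type*} {u : ℝ → α → ℝ} {v : ℝ → β → ℝ} {S : Set ℝ}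
    (hu : ContinuousOn u S) (hv : ContinuousOn v S) :
    ContinuousOn (fun t => (Sum.elim (u t) (v t) : α ⊕ β → ℝ)) S := by
  rw [continuousOn_pi] at *
  rintro (i | i)
  · simpa using hu i
  · simpa using hv i

theorem aux_mulVec_cont {k j : ℕ} (P : Matrix (Fin j) (Fin k) ℝ) {a : ℝ → Fin k → ℝ}
    {S : Set ℝ} (ha : ContinuousOn a S) : ContinuousOn (fun t => P *ᵥ a t) S :=
  (Continuous.matrix_mulVec continuous_const continuous_id).comp_continuousOn ha

theorem aux_dot_cont {k : ℕ} {a b : ℝ → Fin k → ℝ}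
    {S : Set ℝ} (ha : ContinuousOn a S) (hb : ContinuousOn b S) :
    ContinuousOn (fun t => a t ⬝ᵥ b t) S := by
  rw [continuousOn_pi] at ha hb
  exact continuousOn_finsetSum _ (fun i _ => (ha i).mul (hb i))

/-- Sum-of-squares certificate implies dissipativity for polynomial DAE systems: if
`V − ε xᵀx` is a sum of squares and the dissipation-inequality residual is a sum of squares
in `(x, v, w, ξ, ψ)`, then the uncertain polynomial DAE, with uncertainty satisfying the
hard IQC defined by `(Ψ, M)`, is dissipative with respect to the polynomial supply rate. -/
theorem polynomial_dae_dissipativity_of_SOS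
    {n m p l r q nψ nz : ℕ}
    (f : (Fin n → ℝ) → (Fin m → ℝ) → (Fin p → ℝ) → (Fin l → ℝ) → (Fin n → ℝ))
    (g : (Fin n → ℝ) → (Fin m → ℝ) → (Fin p → ℝ) → (Fin l → ℝ) → (Fin r → ℝ))
    (h : (Fin n → ℝ) → (Fin m → ℝ) → (Fin q → ℝ))
    (s : (Fin p → ℝ) → (Fin q → ℝ) → ℝ)
    (hfpoly : ∃ pf : Fin n → MvPolynomial (Fin n ⊕ Fin m ⊕ Fin p ⊕ Fin l) ℝ,
      ∀ (x : Fin n → ℝ) (v : Fin m → ℝ) (w : Fin p → ℝ) (ξ : Fin l → ℝ) (i : Fin n),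
        f x v w ξ i = MvPolynomial.eval (Sum.elim x (Sum.elim v (Sum.elim w ξ))) (pf i))
    (hgpoly : ∃ pg : Fin r → MvPolynomial (Fin n ⊕ Fin m ⊕ Fin p ⊕ Fin l) ℝ,
      ∀ (x : Fin n → ℝ) (v : Fin m → ℝ) (w : Fin p → ℝ) (ξ : Fin l → ℝ) (i : Fin r),
        g x v w ξ i = MvPolynomial.eval (Sum.elim x (Sum.elim v (Sum.elim w ξ))) (pg i))
    (hhpoly : ∃ ph : Fin q → MvPolynomial (Fin n ⊕ Fin m) ℝ,
      ∀ (x : Fin n → ℝ) (v : Fin m → ℝ) (i : Fin q),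
        h x v i = MvPolynomial.eval (Sum.elim x v) (ph i))
    (hspoly : ∃ ps : MvPolynomial (Fin p ⊕ Fin q) ℝ,
      ∀ (w : Fin p → ℝ) (y : Fin q → ℝ), s w y = MvPolynomial.eval (Sum.elim w y) ps)
    (AΨ : Matrix (Fin nψ) (Fin nψ) ℝ) (BΨ : Matrix (Fin nψ) (Fin (n + m + l)) ℝ)
    (CΨ : Matrix (Fin nz) (Fin nψ) ℝ) (DΨ : Matrix (Fin nz) (Fin (n + m + l)) ℝ)
    (M : Matrix (Fin nz) (Fin nz) ℝ) (hM : M.IsSymm)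
    (lam μ ε : ℝ) (hlam : 0 ≤ lam) (hμ : 0 ≤ μ) (hε : 0 < ε)
    (PΔ : Matrix (Fin nψ) (Fin nψ) ℝ) (hPΔ : PΔ.PosSemidef)
    (V : (Fin n → ℝ) → ℝ)
    (hVpoly : ∃ pV : MvPolynomial (Fin n) ℝ,
      ∀ x : Fin n → ℝ, V x = MvPolynomial.eval x pV)
    (hV0 : V 0 = 0)
    (hVSOS : ∃ (N : ℕ) (ps : Fin N → MvPolynomial (Fin n) ℝ),
      ∀ x : Fin n → ℝ,
        V x - ε * (x ⬝ᵥ x) = ∑ i, (MvPolynomial.eval x (ps i)) ^ 2)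
    (hSOS : ∃ (N : ℕ)
        (ps : Fin N → MvPolynomial (Fin n ⊕ Fin m ⊕ Fin p ⊕ Fin l ⊕ Fin nψ) ℝ),
      ∀ (x : Fin n → ℝ) (v : Fin m → ℝ) (w : Fin p → ℝ) (ξ : Fin l → ℝ)
        (ψ : Fin nψ → ℝ),
        s w (h x v) + lam * (g x v w ξ ⬝ᵥ g x v w ξ)
            + μ * ((CΨ *ᵥ ψ + DΨ *ᵥ Fin.append (Fin.append x v) ξ) ⬝ᵥ
                M *ᵥ (CΨ *ᵥ ψ + DΨ *ᵥ Fin.append (Fin.append x v) ξ))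
            - fderiv ℝ V x (f x v w ξ)
            - 2 * (ψ ⬝ᵥ PΔ *ᵥ (AΨ *ᵥ ψ + BΨ *ᵥ Fin.append (Fin.append x v) ξ))
          = ∑ i, (MvPolynomial.eval
              (Sum.elim x (Sum.elim v (Sum.elim w (Sum.elim ξ ψ)))) (ps i)) ^ 2)
    (T : ℝ) (hT : 0 ≤ T)
    (x : ℝ → Fin n → ℝ) (v : ℝ → Fin m → ℝ) (w : ℝ → Fin p → ℝ) (ξ : ℝ → Fin l → ℝ)
    (ψ : ℝ → Fin nψ → ℝ)
    (hv : ContinuousOn v (Set.Icc 0 T)) (hw : ContinuousOn w (Set.Icc 0 T))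
    (hξ : ContinuousOn ξ (Set.Icc 0 T))
    (hx : ∀ t ∈ Set.Icc (0 : ℝ) T, HasDerivAt x (f (x t) (v t) (w t) (ξ t)) t)
    (halg : ∀ t ∈ Set.Icc (0 : ℝ) T, g (x t) (v t) (w t) (ξ t) = 0)
    (hψ0 : ψ 0 = 0)
    (hψ : ∀ t ∈ Set.Icc (0 : ℝ) T,
      HasDerivAt ψ (AΨ *ᵥ ψ t + BΨ *ᵥ Fin.append (Fin.append (x t) (v t)) (ξ t)) t)
    (hIQC : ∀ T' ∈ Set.Icc (0 : ℝ) T,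
      (∫ t in (0 : ℝ)..T',
        (CΨ *ᵥ ψ t + DΨ *ᵥ Fin.append (Fin.append (x t) (v t)) (ξ t)) ⬝ᵥ
          M *ᵥ (CΨ *ᵥ ψ t + DΨ *ᵥ Fin.append (Fin.append (x t) (v t)) (ξ t))) ≤ 0) :
    V (x T) - V (x 0) ≤ ∫ t in (0 : ℝ)..T, s (w t) (h (x t) (v t)) := by
  obtain ⟨ph, hph⟩ := hhpoly
  obtain ⟨ps, hps⟩ := hspoly
  obtain ⟨pV, hpV⟩ := hVpoly
  obtain ⟨N, qs, hqs⟩ := hSOS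
  have hVd : Differentiable ℝ V := by
    have : V = fun x => MvPolynomial.eval x pV := funext hpV
    rw [this]; exact aux_poly_diff pV
  have hxc : ContinuousOn x (Set.Icc 0 T) := fun t ht => (hx t ht).continuousAt.continuousWithinAt
  have hψc : ContinuousOn ψ (Set.Icc 0 T) := fun t ht => (hψ t ht).continuousAt.continuousWithinAt
  have hhc : ContinuousOn (fun t => h (x t) (v t)) (Set.Icc 0 T) := by
    rw [continuousOn_pi]
    intro i
    simp only [hph]
    exact (MvPolynomial.continuous_eval (ph i)).comp_continuousOn (aux_elim_cont hxc hv)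
  have hsc : ContinuousOn (fun t => s (w t) (h (x t) (v t))) (Set.Icc 0 T) := by
    simp only [hps]
    exact (MvPolynomial.continuous_eval ps).comp_continuousOn (aux_elim_cont hw hhc)
  have hzc : ContinuousOn (fun t => CΨ *ᵥ ψ t +
      DΨ *ᵥ Fin.append (Fin.append (x t) (v t)) (ξ t)) (Set.Icc 0 T) :=
    (aux_mulVec_cont _ hψc).add (aux_mulVec_cont _ (aux_append_cont (aux_append_cont hxc hv) hξ))
  have hqc := aux_dot_cont hzc (aux_mulVec_cont M hzc)
  have hsym : ∀ a b : Fin nψ → ℝ, a ⬝ᵥ PΔ *ᵥ b = b ⬝ᵥ PΔ *ᵥ a := by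
    intro a b
    have hP : PΔᵀ = PΔ := by
      have := hPΔ.1
      simpa [Matrix.IsHermitian, Matrix.conjTranspose_eq_transpose_of_trivial] using this
    rw [Matrix.dotProduct_mulVec, ← Matrix.mulVec_transpose, hP, dotProduct_comm]
  have hderiv : ∀ t ∈ Set.Icc (0 : ℝ) T,
      HasDerivAt (fun t => V (x t) + ψ t ⬝ᵥ PΔ *ᵥ ψ t)
        (fderiv ℝ V (x t) (f (x t) (v t) (w t) (ξ t)) + 2 * (ψ t ⬝ᵥ PΔ *ᵥ
          (AΨ *ᵥ ψ t + BΨ *ᵥ Fin.append (Fin.append (x t) (v t)) (ξ t)))) t := by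
    intro t ht
    have h1 := (hVd (x t)).hasFDerivAt.comp_hasDerivAt t (hx t ht)
    have h2 := aux_dot_deriv (hψ t ht) (aux_mulVec_deriv PΔ (hψ t ht))
    rw [hsym _ (ψ t), ← two_mul] at h2
    exact h1.add h2
  have hs_int : IntervalIntegrable (fun t => s (w t) (h (x t) (v t))) volume 0 T :=
    ContinuousOn.intervalIntegrable_of_Icc hT hsc
  have hq_int := ContinuousOn.intervalIntegrable_of_Icc (μ := volume) hT hqc
  have key := intervalIntegral.sub_le_integral_of_hasDeriv_right_of_le hT
    (fun t ht => (hderiv t ht).continuousAt.continuousWithinAt)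
    (fun t ht => (hderiv t (Set.Ioo_subset_Icc_self ht)).hasDerivWithinAt)
    ((hsc.add (hqc.const_mul μ)).integrableOn_Icc)
    (by
      intro t ht
      have h1 := hqs (x t) (v t) (w t) (ξ t) (ψ t)
      rw [halg t (Set.Ioo_subset_Icc_self ht)] at h1
      have h2 : 0 ≤ ∑ i, (MvPolynomial.eval
              (Sum.elim (x t) (Sum.elim (v t) (Sum.elim (w t) (Sum.elim (ξ t) (ψ t)))))
              (qs i)) ^ 2 := Finset.sum_nonneg (fun i _ => sq_nonneg _)
      rw [← h1] at h2
      simp only [dotProduct_zero, mul_zero, add_zero] at h2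
      simp only [Pi.add_apply]
      linarith)
  simp only [Pi.add_apply] at key
  rw [intervalIntegral.integral_add hs_int (hq_int.const_mul μ),
    intervalIntegral.integral_const_mul] at key
  have h3 := mul_nonpos_of_nonneg_of_nonpos hμ (hIQC T ⟨hT, le_rfl⟩)
  have h4 : 0 ≤ ψ T ⬝ᵥ PΔ *ᵥ ψ T := by
    simpa using hPΔ.dotProduct_mulVec_nonneg (ψ T)
  simp only [hψ0, zero_dotProduct, add_zero] at key
  linarith
end
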